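/- arXiv:1308.4203 — 3 statements merged into one kernel-verified Lean document; each statement's English description precedes it below -/
import Mathlib

section
/- The vector (1,φ) belongs to Λ, and for every (a,b) ∈ Ω_φ the vector g_{a,b}·(1,φ) = (a+bφ, φ/a) satisfies 0 < a+bφ ≤ 1, has positive second coordinate, and has slope 1/(a(aφ̄+b)); moreover, for every v ∈ Λ such that g_{a,b}·v = (x,y) satisfies 0 < x ≤ 1 and y > 0, one has y/x ≥ 1/(a(aφ̄+b)). That is, g_{a,b}·(1,φ) is the vector of smallest slope in g_{a,b}Λ ∩ ((0,1]×(0,∞)). -/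
open Matrix MeasureTheory Filter Topology

noncomputable section

abbrev SL2 := Matrix.SpecialLinearGroup (Fin 2) ℝ

/-- The golden ratio φ = (1+√5)/2. -/
def phi : ℝ := (1 + Real.sqrt 5) / 2

/-- φ̄ = 1/φ. -/
def phib : ℝ := phi⁻¹

/-- S = [[0,−1],[1,0]]. -/
def Smat : SL2 := ⟨!![0, -1; 1, 0], by norm_num [Matrix.det_fin_two_of]⟩

/-- P = [[1,φ],[0,1]]. -/
def Pmat : SL2 := ⟨!![1, phi; 0, 1], by norm_num [Matrix.det_fin_two_of]⟩

/-- The Veech group of the golden L: the subgroup generated by S and P. -/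
def Γ : Subgroup SL2 := Subgroup.closure {Smat, Pmat}

/-- Linear action of a 2×2 matrix on ℝ². -/
def mact (g : Matrix (Fin 2) (Fin 2) ℝ) (v : ℝ × ℝ) : ℝ × ℝ :=
  (g 0 0 * v.1 + g 0 1 * v.2, g 1 0 * v.1 + g 1 1 * v.2)

/-- Λ = Γ·(1,0)ᵀ. -/
def Λ : Set (ℝ × ℝ) := {v | ∃ γ ∈ Γ, v = mact (γ : Matrix (Fin 2) (Fin 2) ℝ) (1, 0)}

/-- g_{a,b} = [[a,b],[0,1/a]]. -/
def gab (a b : ℝ) : Matrix (Fin 2) (Fin 2) ℝ := !![a, b; 0, a⁻¹]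

/-- h_s = [[1,0],[−s,1]]. -/
def hmat (s : ℝ) : Matrix (Fin 2) (Fin 2) ℝ := !![1, 0; -s, 1]

/-- Ω = {(a,b) : 0 < a ≤ 1, 1 − aφ < b ≤ 1}. -/
def Ω : Set (ℝ × ℝ) := {p | 0 < p.1 ∧ p.1 ≤ 1 ∧ 1 - p.1 * phi < p.2 ∧ p.2 ≤ 1}

/-- Ω₁ = {(a,b) ∈ Ω : φ̄ ≤ a ≤ 1, 1 − aφ < b ≤ φ̄ − a}. -/
def Ω₁ : Set (ℝ × ℝ) :=
  {p | p ∈ Ω ∧ phib ≤ p.1 ∧ p.1 ≤ 1 ∧ 1 - p.1 * phi < p.2 ∧ p.2 ≤ phib - p.1}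

/-- Ω_φ = {(a,b) ∈ Ω : φ̄² ≤ a ≤ 1, φ̄ − a < b ≤ φ̄ − aφ̄}. -/
def Ωphi : Set (ℝ × ℝ) :=
  {p | p ∈ Ω ∧ phib ^ 2 ≤ p.1 ∧ p.1 ≤ 1 ∧ phib - p.1 < p.2 ∧ p.2 ≤ phib - p.1 * phib}

/-- Ω_∞ = {(a,b) ∈ Ω : φ̄ − aφ̄ < b ≤ 1}. -/
def Ωinf : Set (ℝ × ℝ) := {p | p ∈ Ω ∧ phib - p.1 * phib < p.2 ∧ p.2 ≤ 1}

-- The return time function R.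
open Classical in
noncomputable def Rfun (p : ℝ × ℝ) : ℝ :=
  if p ∈ Ω₁ then 1 / (p.1 * (p.1 + p.2))
  else if p ∈ Ωphi then 1 / (p.1 * (p.1 * phib + p.2))
  else 1 / (p.1 * p.2)

/-- The probability measure m with dm = (2/φ) da db on Ω. -/
noncomputable def m : Measure (ℝ × ℝ) := ENNReal.ofReal (2 / phi) • volume.restrict Ω

-- The golden-L BCZ map T.
open Classical in
noncomputable def Tmap (p : ℝ × ℝ) : ℝ × ℝ :=
  if p ∈ Ω₁ then
    ((p.1 + p.2) * phi,
      p.1 + p.2 * phi +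
        (-(⌊(p.1 + p.2 * phi - 1) / (phi ^ 2 * (p.1 + p.2))⌋ : ℤ) : ℝ) * phi ^ 2 * (p.1 + p.2))
  else if p ∈ Ωphi then
    (p.1 + p.2 * phi,
      p.2 + (-(⌊(p.2 - 1) / (phi * (p.1 + p.2 * phi))⌋ : ℤ) : ℝ) * phi * (p.1 + p.2 * phi))
  else
    (p.2, -p.1 + (-(⌊(-p.1 - 1) / (phi * p.2)⌋ : ℤ) : ℝ) * phi * p.2)

lemma phi_sq : phi * phi = phi + 1 := by
  have h : Real.sqrt 5 * Real.sqrt 5 = 5 := Real.mul_self_sqrt (by norm_num)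
  unfold phi
  linarith

lemma one_lt_phi : 1 < phi := by
  have h : (1 : ℝ) < Real.sqrt 5 := (Real.lt_sqrt (by norm_num)).2 (by norm_num)
  unfold phi
  linarith

lemma phib_eq : phib = phi - 1 := by
  have h := one_lt_phi
  unfold phib
  rw [inv_eq_one_div, div_eq_iff (by positivity)]
  linarith [phi_sq]

/-- The vectors of the golden Farey tree in the closed first quadrant: those obtained from the
coordinate vectors by the four linear maps sending the quadrant onto the cones between
consecutive vectors among `(1, 0), (φ, 1), (φ, φ), (1, φ), (0, 1)`. -/
inductive FareyVec : ℝ → ℝ → Prop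
  | e₁ {u v : ℝ} : u = 1 → v = 0 → FareyVec u v
  | e₂ {u v : ℝ} : u = 0 → v = 1 → FareyVec u v
  | cone₀ {x y u v : ℝ} : FareyVec x y → u = x + phi * y → v = y → FareyVec u v
  | cone₁ {x y u v : ℝ} :
      FareyVec x y → u = phi * x + phi * y → v = x + phi * y → FareyVec u v
  | cone₂ {x y u v : ℝ} :
      FareyVec x y → u = phi * x + y → v = phi * x + phi * y → FareyVec u v
  | cone₃ {x y u v : ℝ} : FareyVec x y → u = x → v = phi * x + y → FareyVec u v

lemma eq_zero_or_one_le_add_mul {x y c : ℝ} (hc : 1 ≤ c) (hx : x = 0 ∨ 1 ≤ x)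
    (hy : y = 0 ∨ 1 ≤ y) : x + c * y = 0 ∨ 1 ≤ x + c * y := by
  rcases hx with rfl | hx <;> rcases hy with rfl | hy
  · left; ring
  · right; nlinarith
  · right; linarith
  · right; nlinarith

lemma FareyVec.eq_zero_or_one_le {u v : ℝ} (h : FareyVec u v) :
    (u = 0 ∨ 1 ≤ u) ∧ (v = 0 ∨ 1 ≤ v) := by
  have hφ := one_lt_phi.le
  have scale : ∀ {t : ℝ}, (t = 0 ∨ 1 ≤ t) → (phi * t = 0 ∨ 1 ≤ phi * t) := fun {t} ht => by
    simpa using eq_zero_or_one_le_add_mul (x := 0) hφ (Or.inl rfl) ht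
  induction h with
  | e₁ hu hv => exact ⟨Or.inr hu.ge, Or.inl hv⟩
  | e₂ hu hv => exact ⟨Or.inl hu, Or.inr hv.ge⟩
  | cone₀ _ hu hv ih =>
    subst hu hv
    exact ⟨eq_zero_or_one_le_add_mul hφ ih.1 ih.2, ih.2⟩
  | cone₁ _ hu hv ih =>
    subst hu hv
    exact ⟨eq_zero_or_one_le_add_mul hφ (scale ih.1) ih.2,
      eq_zero_or_one_le_add_mul hφ ih.1 ih.2⟩
  | cone₂ _ hu hv ih =>
    subst hu hv
    exact ⟨by simpa using eq_zero_or_one_le_add_mul le_rfl (scale ih.1) ih.2,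
      eq_zero_or_one_le_add_mul hφ (scale ih.1) ih.2⟩
  | cone₃ _ hu hv ih =>
    subst hu hv
    exact ⟨ih.1, by simpa using eq_zero_or_one_le_add_mul le_rfl (scale ih.1) ih.2⟩

lemma FareyVec.nonneg {u v : ℝ} (h : FareyVec u v) : 0 ≤ u ∧ 0 ≤ v := by
  obtain ⟨hu, hv⟩ := h.eq_zero_or_one_le
  constructor
  · rcases hu with hu | hu <;> linarith
  · rcases hv with hv | hv <;> linarith

/-- The union of the four quarter-turn images of the Farey vectors. -/
def RotFareyVec (x y : ℝ) : Prop :=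
  FareyVec x y ∨ FareyVec (-x) (-y) ∨ FareyVec y (-x) ∨ FareyVec (-y) x

lemma RotFareyVec.neg {x y : ℝ} (h : RotFareyVec x y) : RotFareyVec (-x) (-y) := by
  unfold RotFareyVec at *
  simp only [neg_neg]
  tauto

lemma RotFareyVec.rotate {x y : ℝ} (h : RotFareyVec x y) : RotFareyVec (-y) x := by
  unfold RotFareyVec at *
  simp only [neg_neg]
  tauto

lemma RotFareyVec.rotate_symm {x y : ℝ} (h : RotFareyVec x y) : RotFareyVec y (-x) := by
  simpa using h.rotate.neg

lemma FareyVec.shear_rotate {x y : ℝ} (h : FareyVec x y) :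
    RotFareyVec (phi * x - y) x := by
  have hφ := phi_sq
  cases h with
  | e₁ hu hv =>
    subst hu hv
    exact Or.inl (.cone₀ (.e₂ rfl rfl) (by ring) rfl)
  | e₂ hu hv =>
    subst hu hv
    exact Or.inr (Or.inl (.e₁ (by ring) (by ring)))
  | @cone₀ s t _ _ h hu hv =>
    exact Or.inl (.cone₁ h (by rw [hu, hv]; linear_combination t * hφ) hu)
  | @cone₁ s t _ _ h hu hv =>
    exact Or.inl (.cone₂ h (by rw [hu, hv]; linear_combination (s + t) * hφ) hu)
  | @cone₂ s t _ _ h hu hv =>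
    exact Or.inl (.cone₃ h (by rw [hu, hv]; linear_combination s * hφ) hu)
  | cone₃ h hu hv =>
    refine Or.inr (Or.inr (Or.inl ?_))
    convert h using 1
    subst hu hv
    ring

lemma FareyVec.unshear {x y : ℝ} (h : FareyVec x y) : RotFareyVec (x - phi * y) y := by
  have hφ := phi_sq
  cases h with
  | e₁ hu hv => exact Or.inl (.e₁ (by rw [hu, hv]; ring) hv)
  | e₂ hu hv =>
    exact Or.inr (Or.inr (Or.inl (.cone₃ (.e₁ rfl rfl) hv (by rw [hu, hv]; ring))))
  | cone₀ h hu hv =>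
    refine Or.inl ?_
    convert h using 1
    rw [hu, hv]
    ring
  | @cone₁ s t _ _ h hu hv =>
    exact Or.inr (Or.inr (Or.inl (.cone₀ h hv (by rw [hu, hv]; linear_combination t * hφ))))
  | @cone₂ s t _ _ h hu hv =>
    exact Or.inr (Or.inr (Or.inl
      (.cone₁ h hv (by rw [hu, hv]; linear_combination (s + t) * hφ))))
  | @cone₃ s t _ _ h hu hv =>
    exact Or.inr (Or.inr (Or.inl (.cone₂ h hv (by rw [hu, hv]; linear_combination s * hφ))))

lemma RotFareyVec.shear {x y : ℝ} (h : RotFareyVec x y) : RotFareyVec (x + phi * y) y := by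
  rcases h with h | h | h | h
  · exact Or.inl (.cone₀ h rfl rfl)
  · exact Or.inr (Or.inl (.cone₀ h (by ring) rfl))
  · convert h.shear_rotate using 1
    ring
  · convert h.shear_rotate.neg using 1 <;> ring

lemma RotFareyVec.unshear {x y : ℝ} (h : RotFareyVec x y) : RotFareyVec (x - phi * y) y := by
  rcases h with h | h | h | h
  · exact h.unshear
  · convert h.unshear.neg using 1 <;> ring
  · exact Or.inr (Or.inr (Or.inl (.cone₃ h rfl (by ring))))
  · exact Or.inr (Or.inr (Or.inr (.cone₃ h rfl (by ring))))

lemma mact_mul (g h : Matrix (Fin 2) (Fin 2) ℝ) (v : ℝ × ℝ) :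
    mact (g * h) v = mact g (mact h v) := by
  simp only [mact, Matrix.mul_apply, Fin.sum_univ_two]
  ext <;> ring

lemma coe_Smat_inv : ((Smat⁻¹ : SL2) : Matrix (Fin 2) (Fin 2) ℝ) = !![0, 1; -1, 0] := by
  rw [Matrix.SpecialLinearGroup.coe_inv, Matrix.adjugate_fin_two]
  simp [Smat]

lemma coe_Pmat_inv : ((Pmat⁻¹ : SL2) : Matrix (Fin 2) (Fin 2) ℝ) = !![1, -phi; 0, 1] := by
  rw [Matrix.SpecialLinearGroup.coe_inv, Matrix.adjugate_fin_two]
  simp [Pmat]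

lemma rotFareyVec_mact {γ : SL2} (hγ : γ ∈ Γ) {v : ℝ × ℝ} (hv : RotFareyVec v.1 v.2) :
    RotFareyVec (mact (γ : Matrix (Fin 2) (Fin 2) ℝ) v).1
      (mact (γ : Matrix (Fin 2) (Fin 2) ℝ) v).2 := by
  induction hγ using Subgroup.closure_induction_left with
  | one => simpa [mact] using hv
  | mul_left x hx y _ ih =>
    rw [Matrix.SpecialLinearGroup.coe_mul, mact_mul]
    rcases hx with rfl | rfl
    · simpa [mact, Smat] using ih.rotate
    · simpa [mact, Pmat] using ih.shear
  | inv_mul_cancel x hx y _ ih =>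
    rw [Matrix.SpecialLinearGroup.coe_mul, mact_mul]
    rcases hx with rfl | rfl
    · rw [coe_Smat_inv]
      simpa [mact] using ih.rotate_symm
    · rw [coe_Pmat_inv]
      simpa [mact, sub_eq_add_neg] using ih.unshear

lemma rotFareyVec_of_mem {v : ℝ × ℝ} (hv : v ∈ Λ) : RotFareyVec v.1 v.2 := by
  obtain ⟨γ, hγ, rfl⟩ := hv
  exact rotFareyVec_mact hγ (Or.inl (.e₁ rfl rfl))

lemma one_phi_mem : (1, phi) ∈ Λ := by
  have hS : Smat ∈ Γ := Subgroup.subset_closure (by simp)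
  have hP : Pmat ∈ Γ := Subgroup.subset_closure (by simp)
  refine ⟨Smat * Pmat⁻¹ * Smat⁻¹, mul_mem (mul_mem hS (inv_mem hP)) (inv_mem hS), ?_⟩
  rw [Matrix.SpecialLinearGroup.coe_mul, Matrix.SpecialLinearGroup.coe_mul, mact_mul, mact_mul,
    coe_Smat_inv, coe_Pmat_inv]
  simp [mact, Smat]

/-- A linear form which is positive on `(1, 0)` and `(1, φ)` and exceeds `1` on `(φ, 1)` and
`(φ, φ)` exceeds `1` on all Farey vectors strictly between `(1, 0)` and `(1, φ)`. -/
lemma FareyVec.one_lt_of_slope_lt {a b x y : ℝ} (h : FareyVec x y) (hy : 0 < y)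
    (hxy : y < phi * x) (ha : 0 < a) (h₁ : 1 < a * phi + b) (h₂ : 1 < phi * (a + b))
    (h₃ : 0 < a + b * phi) : 1 < a * x + b * y := by
  have hφ := one_lt_phi
  cases h with
  | e₁ hu hv => linarith
  | e₂ hu hv => subst hu; linarith
  | @cone₀ s t _ _ h hu hv =>
    obtain ⟨-, ht⟩ := h.eq_zero_or_one_le
    have hs := h.nonneg.1
    rcases ht with ht | ht
    · linarith
    · have : a * x + b * y = s * a + t * (a * phi + b) := by rw [hu, hv]; ring
      nlinarith [mul_nonneg hs ha.le]
  | @cone₁ s t _ _ h hu hv =>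
    obtain ⟨hs, ht⟩ := h.eq_zero_or_one_le
    have e : a * x + b * y = s * (a * phi + b) + t * (phi * (a + b)) := by rw [hu, hv]; ring
    rw [e]
    rcases hs with rfl | hs <;> rcases ht with rfl | ht
    · norm_num at hv; linarith
    · nlinarith
    · nlinarith
    · nlinarith
  | @cone₂ s t _ _ h hu hv =>
    obtain ⟨hs, -⟩ := h.eq_zero_or_one_le
    have ht := h.nonneg.2
    rcases hs with rfl | hs
    · subst hu hv; linarith
    · have : a * x + b * y = s * (phi * (a + b)) + t * (a + b * phi) := by rw [hu, hv]; ring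
      nlinarith [mul_nonneg ht h₃.le]
  | @cone₃ s t _ _ h hu hv =>
    have := h.nonneg.2
    subst hu hv
    linarith

lemma RotFareyVec.fareyVec {x y : ℝ} (h : RotFareyVec x y) (hx : 0 < x) (hy : 0 < y) :
    FareyVec x y := by
  rcases h with h | h | h | h
  · exact h
  · linarith [h.nonneg.1]
  · linarith [h.nonneg.2]
  · linarith [h.nonneg.1]

/-- On Ω_φ, the vector g_{a,b}·(1,φ) = (a+bφ, φ/a) is the vector of smallest slope in
g_{a,b}Λ ∩ ((0,1]×(0,∞)), with slope 1/(a(aφ̄+b)). -/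
theorem smallest_slope_Omega_phi :
    (1, phi) ∈ Λ ∧
    ∀ a b : ℝ, (a, b) ∈ Ωphi →
      (mact (gab a b) (1, phi) = (a + b * phi, phi / a) ∧
        0 < a + b * phi ∧ a + b * phi ≤ 1 ∧ 0 < phi / a ∧
        (phi / a) / (a + b * phi) = 1 / (a * (a * phib + b))) ∧
      ∀ v ∈ Λ, 0 < (mact (gab a b) v).1 → (mact (gab a b) v).1 ≤ 1 →
        0 < (mact (gab a b) v).2 →
        1 / (a * (a * phib + b)) ≤ (mact (gab a b) v).2 / (mact (gab a b) v).1 := by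
  refine ⟨one_phi_mem, fun a b hab => ?_⟩
  obtain ⟨⟨ha, ha1, hb, -⟩, -, -, hb₁, hb₂⟩ := hab
  dsimp only at ha ha1 hb hb₁ hb₂
  rw [phib_eq] at hb₁ hb₂ ⊢
  have hφ := one_lt_phi
  have hsq := phi_sq
  have hden : 0 < a * (phi - 1) + b := by
    nlinarith [mul_nonneg (sub_nonneg.2 ha1) (sub_nonneg.2 hφ.le)]
  have heq : a + b * phi = phi * (a * (phi - 1) + b) := by linear_combination -a * hsq
  have hpos : 0 < a + b * phi := by rw [heq]; positivity
  have hle : a + b * phi ≤ 1 := by nlinarith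
  have hsum : 1 < phi * (a + b) := by nlinarith
  have hφ0 : 0 < phi := by linarith
  refine ⟨⟨?_, hpos, hle, by positivity, ?_⟩, ?_⟩
  · simp [mact, gab]
    field_simp
  · rw [heq]
    field_simp
  · rintro ⟨x, y⟩ hv hx hx1 hy
    simp only [mact, gab, Matrix.of_apply, Matrix.cons_val', Matrix.cons_val_zero,
      Matrix.cons_val_one, Matrix.cons_val_fin_one, zero_mul, zero_add] at hx hx1 hy ⊢
    have hy' : 0 < y := pos_of_mul_pos_right hy (inv_pos.2 ha).le
    have hxy : phi * x ≤ y := by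
      by_contra! hlt
      have hx' : 0 < x := pos_of_mul_pos_right (hy'.trans hlt) hφ0.le
      have := ((rotFareyVec_of_mem hv).fareyVec hx' hy').one_lt_of_slope_lt
        hy' hlt ha (by linarith) hsum hpos
      linarith
    have hx_le : x ≤ (phi - 1) * y := by nlinarith
    rw [inv_mul_eq_div, div_div, div_le_div_iff₀ (by positivity) (by positivity)]
    nlinarith [mul_nonneg (mul_nonneg ha.le ha.le) (sub_nonneg.2 hx_le)]
end
end

section
/- The return time function is uniformly bounded below by 1: for every (a,b) ∈ Ω, R(a,b) ≥ 1. Consequently the limiting gap distribution has no support in [0,1] (there are no small gaps). -/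
open Matrix MeasureTheory Filter Topology

noncomputable section

theorem phi_pos : 0 < phi := by unfold phi; positivity

theorem phib_pos : 0 < phib := inv_pos.mpr phi_pos

theorem phi_eq_one_add_phib : phi = 1 + phib := by
  have h : phi * phi = phi + 1 := by
    unfold phi
    linear_combination (1 / 4 : ℝ) * Real.sq_sqrt (show (0 : ℝ) ≤ 5 by norm_num)
  have h' : phib * phi = 1 := inv_mul_cancel₀ phi_pos.ne'
  linear_combination phib * h + (1 - phi) * h'

theorem phib_lt_one : phib < 1 :=
  inv_lt_one_of_one_lt₀ (by linarith [phi_eq_one_add_phib, phib_pos])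

/-- If a point of `Ω` lies in neither `Ω₁` nor `Ωphi`, its second coordinate is positive. -/
theorem snd_pos_of_notMem {p : ℝ × ℝ} (hp : p ∈ Ω) (h₁ : p ∉ Ω₁) (h₂ : p ∉ Ωphi) :
    0 < p.2 := by
  obtain ⟨a, b⟩ := p
  obtain ⟨ha, ha1, hb, hb1⟩ := id hp
  dsimp only at *
  have hphib := phib_pos
  have hphib1 := phib_lt_one
  by_contra! hb0
  have hle : phib ≤ a := by
    rw [phib, inv_le_iff_one_le_mul₀ phi_pos]
    linarith
  have hlt : phib - a < b := by
    by_contra! hba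
    exact h₁ ⟨hp, hle, ha1, hb, hba⟩
  exact h₂ ⟨hp, by dsimp only; nlinarith, ha1, hlt, by dsimp only; nlinarith⟩

theorem one_le_Rfun {p : ℝ × ℝ} (hp : p ∈ Ω) : 1 ≤ Rfun p := by
  have bound {a c : ℝ} (ha : 0 < a) (ha1 : a ≤ 1) (hc : 0 < c) (hc1 : c ≤ 1) :
      1 ≤ 1 / (a * c) :=
    one_le_one_div (mul_pos ha hc) (mul_le_one₀ ha1 hc.le hc1)
  have hphib := phib_pos
  have hphib1 := phib_lt_one
  obtain ⟨ha, ha1, hb, hb1⟩ := id hp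
  rw [phi_eq_one_add_phib] at hb
  unfold Rfun
  split_ifs with h₁ h₂
  · obtain ⟨-, -, -, -, hle⟩ := h₁
    exact bound ha ha1 (by nlinarith) (by linarith)
  · obtain ⟨-, -, -, -, hle⟩ := h₂
    exact bound ha ha1 (by nlinarith) (by linarith)
  · exact bound ha ha1 (snd_pos_of_notMem hp h₁ h₂) hb1

/-- The return time function is uniformly bounded below by 1; consequently the limiting
gap distribution has no support in [0,1]. -/
theorem return_time_ge_one :
    (∀ p ∈ Ω, 1 ≤ Rfun p) ∧
    (∀ t : ℝ, t ≤ 1 → m {p : ℝ × ℝ | p ∈ Ω ∧ Rfun p < t} = 0) := by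
  refine ⟨fun p hp => one_le_Rfun hp, fun t ht => ?_⟩
  have hempty : {p : ℝ × ℝ | p ∈ Ω ∧ Rfun p < t} = ∅ :=
    Set.eq_empty_of_forall_notMem fun p hp =>
      (ht.trans (one_le_Rfun hp.1)).not_gt hp.2
  rw [hempty, measure_empty]
end
end

section
/- For every α with 1 ≤ α ≤ 4φ, the two-dimensional Lebesgue measure of the set {(x,y) ∈ Ω_∞ : x·y > 1/α} equals 1 − (1 + ln α)/α. -/
open Matrix MeasureTheory Filter Topology

noncomputable section

/-- Both lower boundary lines of `Ωinf` lie below the hyperbola `x * y = 1 / α` when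
`α ≤ 4 * phi`, so the region is cut out by `x ≤ 1`, `y ≤ 1` and the hyperbola alone. -/
theorem mem_Ωinf_and_lt_mul_iff {α : ℝ} (hα : 1 ≤ α) (hα' : α ≤ 4 * phi) (p : ℝ × ℝ) :
    p ∈ Ωinf ∧ 1 / α < p.1 * p.2 ↔
      p.1 ∈ Set.Ioc α⁻¹ 1 ∧ p.2 ∈ Set.Ioc (α⁻¹ * p.1⁻¹) 1 := by
  obtain ⟨x, y⟩ := p
  have hα0 : 0 < α := by linarith
  have hφ := phi_pos
  have hinv : 0 < α⁻¹ := inv_pos.2 hα0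
  simp only [Ωinf, Ω, phib, Set.mem_ofPred_eq, Set.mem_Ioc, one_div]
  constructor
  · rintro ⟨⟨⟨hx, hx1, -, hy1⟩, -, -⟩, h⟩
    refine ⟨⟨by nlinarith, hx1⟩, ?_, hy1⟩
    rwa [← div_eq_mul_inv, div_lt_iff₀' hx]
  · rintro ⟨⟨hx, hx1⟩, hy, hy1⟩
    have hx0 : 0 < x := hinv.trans hx
    rw [← div_eq_mul_inv, div_lt_iff₀' hx0] at hy
    have hle : (4 * phi)⁻¹ ≤ α⁻¹ := inv_anti₀ hα0 hα'
    have hxy : 1 < 4 * phi * (x * y) := by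
      have := hle.trans_lt hy
      rwa [inv_lt_iff_one_lt_mul₀' (by positivity)] at this
    refine ⟨⟨⟨hx0, hx1, ?_, hy1⟩, ?_, hy1⟩, hy⟩
    · have : 0 < 4 * phi * x * (y - (1 - x * phi)) := by
        nlinarith [sq_nonneg (2 * phi * x - 1)]
      linarith [pos_of_mul_pos_right this (by positivity)]
    · have : 0 < 4 * phi * x * (y - (phi⁻¹ - x * phi⁻¹)) := by
        have h1 : 4 * phi * x * (y - (phi⁻¹ - x * phi⁻¹))
            = 4 * phi * (x * y) - 4 * x * (1 - x) := by
          field_simp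
        nlinarith [sq_nonneg (2 * x - 1)]
      linarith [pos_of_mul_pos_right this (by positivity)]

theorem integral_one_sub_inv_mul_inv {α : ℝ} (hα : 1 ≤ α) :
    ∫ x in α⁻¹..1, (1 - α⁻¹ * x⁻¹) = 1 - (1 + Real.log α) / α := by
  have hα0 : 0 < α := by linarith
  have hinv : 0 < α⁻¹ := inv_pos.2 hα0
  have hint : IntervalIntegrable (fun x : ℝ => x⁻¹) volume α⁻¹ 1 :=
    intervalIntegrable_inv_iff.2 (Or.inr (Set.notMem_uIcc_of_lt hinv one_pos))
  rw [intervalIntegral.integral_sub (by simp) (hint.const_mul _),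
    intervalIntegral.integral_const_mul, integral_inv_of_pos hinv one_pos]
  simp
  ring

theorem volume_region_above_hyperbola {α : ℝ} (hα : 1 ≤ α) :
    volume {p : ℝ × ℝ | p.1 ∈ Set.Ioc α⁻¹ 1 ∧ p.2 ∈ Set.Ioc (α⁻¹ * p.1⁻¹) 1}
      = ENNReal.ofReal (1 - (1 + Real.log α) / α) := by
  have hα0 : 0 < α := by linarith
  have hinv : 0 < α⁻¹ := inv_pos.2 hα0
  have hmeas : MeasurableSet
      {p : ℝ × ℝ | p.1 ∈ Set.Ioc α⁻¹ 1 ∧ p.2 ∈ Set.Ioc (α⁻¹ * p.1⁻¹) 1} := by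
    simp only [Set.mem_Ioc]
    measurability
  have hslice : ∀ x : ℝ, volume (Prod.mk x ⁻¹'
      {p : ℝ × ℝ | p.1 ∈ Set.Ioc α⁻¹ 1 ∧ p.2 ∈ Set.Ioc (α⁻¹ * p.1⁻¹) 1})
      = (Set.Ioc α⁻¹ 1).indicator (fun x => ENNReal.ofReal (1 - α⁻¹ * x⁻¹)) x := by
    intro x
    by_cases hx : x ∈ Set.Ioc α⁻¹ 1
    · rw [Set.indicator_of_mem hx, ← Real.volume_Ioc]
      congr 1
      ext y
      simp [hx.1, hx.2]
    · rw [Set.indicator_of_notMem hx]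
      simp only [Set.preimage_ofPred_eq, hx, false_and, Set.ofPred_false, measure_empty]
  have hcont : ContinuousOn (fun x : ℝ => 1 - α⁻¹ * x⁻¹) (Set.Icc α⁻¹ 1) :=
    continuousOn_const.sub (continuousOn_const.mul
      (continuousOn_inv₀.mono fun x hx => (hinv.trans_le hx.1).ne'))
  rw [Measure.volume_eq_prod, Measure.prod_apply hmeas, lintegral_congr hslice,
    lintegral_indicator measurableSet_Ioc, ← ofReal_integral_eq_lintegral_ofReal,
    ← intervalIntegral.integral_of_le (inv_le_one_of_one_le₀ hα),
    integral_one_sub_inv_mul_inv hα]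
  · exact hcont.integrableOn_Icc.mono_set Set.Ioc_subset_Icc_self
  · refine (ae_restrict_iff' measurableSet_Ioc).2 (ae_of_all _ fun x hx => ?_)
    have hx0 : 0 < x := hinv.trans hx.1
    have : α⁻¹ / x ≤ 1 := (div_le_one hx0).2 hx.1.le
    simpa [← div_eq_mul_inv] using this

/-- For 1 ≤ α ≤ 4φ, the area of {(x,y) ∈ Ω_∞ : xy > 1/α} equals 1 − (1 + ln α)/α. -/
theorem F_inf_second_piece :
    ∀ α : ℝ, 1 ≤ α → α ≤ 4 * phi →
      (volume {p : ℝ × ℝ | p ∈ Ωinf ∧ 1 / α < p.1 * p.2}).toReal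
        = 1 - (1 + Real.log α) / α := by
  intro α hα hα'
  have hnonneg : 0 ≤ 1 - (1 + Real.log α) / α := by
    have hα0 : 0 < α := by linarith
    rw [sub_nonneg, div_le_one hα0]
    linarith [Real.log_le_sub_one_of_pos hα0]
  simp only [mem_Ωinf_and_lt_mul_iff hα hα']
  rw [volume_region_above_hyperbola hα, ENNReal.toReal_ofReal hnonneg]
end
end
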